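/- arXiv:2205.11782 — 7 statements merged into one kernel-verified Lean document; each statement's English description precedes it below -/
import Mathlib

section
/- Let m ≥ 1 be an integer and A a real number with -m ≤ A < m. Set k = ⌊(A+m)/2⌋ and r = A + m - 1 - 2k. Then for every real number B with A²/m ≤ B ≤ m - 1 + r² there exists y = (y_1,…,y_m) ∈ [-1,1]^m such that Σ_{i=1}^m y_i = A and Σ_{i=1}^m y_i² = B. -/
open Finset

lemma aux_sum (K l : ℕ) (a b c : ℝ) :
    ∑ i ∈ range (K + 1 + l), (if i < K then a else if i = K then b else c)
      = K * a + b + l * c := by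
  induction l with
  | zero =>
    rw [Nat.add_zero, sum_range_succ, sum_congr rfl (g := fun _ => a)]
    · simp
    · intro i hi
      rw [if_pos (mem_range.1 hi)]
  | succ l ih =>
    rw [← Nat.add_assoc, sum_range_succ, ih, if_neg (by omega), if_neg (by omega)]
    push_cast
    ring

/-- Feasibility: for every `B` between the constrained minimum `A²/m` and the constrained
maximum `m - 1 + r²` of `Σ yᵢ²`, there is a vector `y ∈ [-1,1]^m` with `Σ yᵢ = A` and
`Σ yᵢ² = B`. -/
theorem stmt_2 (m : ℕ) (hm : 1 ≤ m) (A : ℝ) (hA₁ : -(m : ℝ) ≤ A) (hA₂ : A < m) :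
    let k : ℤ := ⌊(A + m) / 2⌋
    let r : ℝ := A + m - 1 - 2 * k
    ∀ B : ℝ, A ^ 2 / m ≤ B → B ≤ (m : ℝ) - 1 + r ^ 2 →
      ∃ y : Fin m → ℝ, (∀ i, y i ∈ Set.Icc (-1 : ℝ) 1) ∧
        (∑ i, y i) = A ∧ (∑ i, (y i) ^ 2) = B := by
  intro k r B hB1 hB2
  have hm0 : (0 : ℝ) < m := by exact_mod_cast hm
  have hk0 : 0 ≤ k := Int.floor_nonneg.2 (by linarith)
  have hk1 : (k : ℝ) ≤ (A + m) / 2 := Int.floor_le _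
  have hk2 : (A + m) / 2 < k + 1 := Int.lt_floor_add_one _
  have hkm : k < m := by
    have : (k : ℝ) < (m : ℝ) := by linarith
    exact_mod_cast this
  have hr1 : -1 ≤ r := by simp only [r]; linarith
  have hr2 : r ≤ 1 := by simp only [r]; linarith
  have hr : r = A + m - 1 - 2 * k := rfl
  clear_value r k
  lift k to ℕ using hk0 with K
  obtain ⟨l, hl⟩ : ∃ l, m = K + 1 + l := ⟨m - (K + 1), by omega⟩
  have hlR : (m : ℝ) = K + 1 + l := by rw [hl]; push_cast; ring
  push_cast at hr
  let v : ℕ → ℝ := fun i => if i < K then 1 else if i = K then r else -1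
  have hv : ∀ i, v i ∈ Set.Icc (-1 : ℝ) 1 := by
    intro i
    simp only [v]
    split_ifs <;> constructor <;> linarith
  have hvs : ∑ i : Fin m, v i = A := by
    rw [Fin.sum_univ_eq_sum_range v m, hl, aux_sum]
    linarith
  have hvq : ∑ i : Fin m, v i ^ 2 = m - 1 + r ^ 2 := by
    have : ∀ i, v i ^ 2 = if i < K then 1 else if i = K then r ^ 2 else 1 := by
      intro i
      simp only [v]
      split_ifs <;> ring
    rw [Fin.sum_univ_eq_sum_range (fun i => v i ^ 2) m]
    simp only [this]
    rw [hl, aux_sum]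
    push_cast
    ring
  let F : ℝ → ℝ := fun t => ∑ i : Fin m, ((1 - t) * (A / m) + t * v i) ^ 2
  have hF : ContinuousOn F (Set.Icc 0 1) := by
    apply Continuous.continuousOn
    fun_prop
  have hF0 : F 0 = A ^ 2 / m := by
    simp [F]
    field_simp
  have hF1 : F 1 = m - 1 + r ^ 2 := by
    rw [← hvq]; simp [F]
  obtain ⟨t, ⟨ht0, ht1⟩, htB⟩ := intermediate_value_Icc zero_le_one hF
    (show B ∈ Set.Icc (F 0) (F 1) by rw [hF0, hF1]; exact ⟨hB1, hB2⟩)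
  refine ⟨fun i => (1 - t) * (A / m) + t * v i, ?_, ?_, htB⟩
  · intro i
    have hc : A / m ∈ Set.Icc (-1 : ℝ) 1 := by
      constructor
      · rw [le_div_iff₀ hm0]; linarith
      · rw [div_le_iff₀ hm0]; linarith
    exact (convex_Icc (-1 : ℝ) 1) hc (hv i) (by linarith) ht0 (by ring)
  · rw [sum_add_distrib, ← mul_sum, ← mul_sum, hvs]
    simp
    field_simp
    ring
end

section
/- Fix ε > 0 and let p = e^ε/(1+e^ε), q = 1 - p, t = p - q. Let x_1,…,x_n ∈ [-1,1] with mean μ = (1/n)Σ_{i=1}^n x_i, and let X'_1,…,X'_n be independent random variables where X'_i is the output of the SR mechanism on input x_i. Let μ̂_SR = (1/n)Σ_{i=1}^n X'_i/t. Then E[(μ̂_SR - μ)²] = (n - t² Σ_{i=1}^n x_i²) / (n² t²). -/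
open Finset

theorem sr_cons (n : ℕ) (F : (Fin (n+1) → Bool) → ℝ) :
    ∑ σ, F σ = (∑ σ : Fin n → Bool, F (Fin.cons true σ)) + ∑ σ : Fin n → Bool, F (Fin.cons false σ) := by
  rw [← (Fin.consEquiv (fun _ : Fin (n+1) => Bool)).sum_comp, Fintype.sum_prod_type]
  simp [Fin.consEquiv]

theorem sr_aux (n : ℕ) (w f : Fin n → Bool → ℝ)
    (h1 : ∀ i, w i true + w i false = 1)
    (h2 : ∀ i, w i true * f i true + w i false * f i false = 0) :
    (∑ σ : Fin n → Bool, ∏ i, w i (σ i)) = 1 ∧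
    (∑ σ : Fin n → Bool, (∏ i, w i (σ i)) * ∑ i, f i (σ i)) = 0 ∧
    (∑ σ : Fin n → Bool, (∏ i, w i (σ i)) * (∑ i, f i (σ i)) ^ 2) =
      ∑ i, (w i true * f i true ^ 2 + w i false * f i false ^ 2) := by
  induction n with
  | zero => simp
  | succ n ih =>
    obtain ⟨a, b, c⟩ := ih (fun i => w i.succ) (fun i => f i.succ)
      (fun i => h1 _) (fun i => h2 _)
    have e1 := h1 0
    have e2 := h2 0
    have k1 : ∀ u : ℝ, ∑ σ : Fin n → Bool, u * ∏ i, w i.succ (σ i) = u := by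
      intro u
      rw [← Finset.mul_sum, a, mul_one]
    have k2 : ∀ u v : ℝ, ∑ σ : Fin n → Bool,
        (u * ∏ i, w i.succ (σ i)) * (v + ∑ i, f i.succ (σ i)) = u * v := by
      intro u v
      calc _ = u * v * (∑ σ : Fin n → Bool, ∏ i, w i.succ (σ i)) +
            u * ∑ σ : Fin n → Bool, (∏ i, w i.succ (σ i)) * ∑ i, f i.succ (σ i) := by
            rw [Finset.mul_sum, Finset.mul_sum, ← Finset.sum_add_distrib]
            exact Finset.sum_congr rfl fun σ _ => by ring
        _ = _ := by rw [a, b]; ring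
    have k3 : ∀ u v : ℝ, ∑ σ : Fin n → Bool,
        (u * ∏ i, w i.succ (σ i)) * (v + ∑ i, f i.succ (σ i)) ^ 2 = u * v ^ 2 +
          u * ∑ i : Fin n, (w i.succ true * f i.succ true ^ 2
            + w i.succ false * f i.succ false ^ 2) := by
      intro u v
      calc _ = u * v ^ 2 * (∑ σ : Fin n → Bool, ∏ i, w i.succ (σ i)) +
            2 * u * v * (∑ σ : Fin n → Bool, (∏ i, w i.succ (σ i)) * ∑ i, f i.succ (σ i)) +
            u * (∑ σ : Fin n → Bool, (∏ i, w i.succ (σ i)) * (∑ i, f i.succ (σ i)) ^ 2) := by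
            rw [Finset.mul_sum, Finset.mul_sum, Finset.mul_sum, ← Finset.sum_add_distrib,
              ← Finset.sum_add_distrib]
            exact Finset.sum_congr rfl fun σ _ => by ring
        _ = _ := by rw [a, b, c]; ring
    refine ⟨?_, ?_, ?_⟩
    · rw [sr_cons]
      simp only [Fin.prod_univ_succ, Fin.cons_zero, Fin.cons_succ, k1]
      exact e1
    · rw [sr_cons]
      simp only [Fin.prod_univ_succ, Fin.sum_univ_succ, Fin.cons_zero, Fin.cons_succ, k2]
      exact e2
    · rw [sr_cons]
      simp only [Fin.prod_univ_succ, Fin.sum_univ_succ (n := n), Fin.cons_zero, Fin.cons_succ, k3]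
      linear_combination (∑ i : Fin n, (w i.succ true * f i.succ true ^ 2
            + w i.succ false * f i.succ false ^ 2)) * e1

/-- SR part of Lemma 1 of the paper: for `n` independent SR reports of values
`x₁,…,xₙ ∈ [-1,1]`, the mean squared error of the SR estimator
`μ̂ = (1/n) Σ X'ᵢ/t` around `μ = (1/n) Σ xᵢ` equals `(n - t² Σ xᵢ²)/(n² t²)`.
The expectation is written as a sum over all outcomes `σ ∈ {-1,1}ⁿ` (encoded by
`σ : Fin n → Bool`), weighted by the product of the SR output probabilities. -/
theorem stmt_5 (ε : ℝ) (hε : 0 < ε) (n : ℕ) (hn : 0 < n)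
    (x : Fin n → ℝ) (hx : ∀ i, x i ∈ Set.Icc (-1 : ℝ) 1) :
    let p : ℝ := Real.exp ε / (1 + Real.exp ε)
    let q : ℝ := 1 - p
    let t : ℝ := p - q
    let prob : (Fin n → Bool) → ℝ := fun σ =>
      ∏ i, (if σ i then q + t * (1 + x i) / 2 else q + t * (1 - x i) / 2)
    let val : Bool → ℝ := fun b => if b then 1 else -1
    let μ : ℝ := (∑ i, x i) / n
    (∑ σ : Fin n → Bool, prob σ * ((∑ i, val (σ i) / t) / n - μ) ^ 2) =
      ((n : ℝ) - t ^ 2 * ∑ i, (x i) ^ 2) / ((n : ℝ) ^ 2 * t ^ 2) := by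
  intro p q t prob val μ
  have hE : 1 < Real.exp ε := Real.one_lt_exp_iff.mpr hε
  have ht : t ≠ 0 := by
    have : t = (Real.exp ε - 1) / (1 + Real.exp ε) := by
      simp only [t, q, p]
      field_simp
      ring
    rw [this]
    exact div_ne_zero (by linarith) (by linarith)
  have hq : q = (1 - t) / 2 := by simp only [t, q]; ring
  have hn' : (n : ℝ) ≠ 0 := by positivity
  clear_value t
  clear_value q
  subst hq
  have key := (sr_aux n
    (fun i b => if b then (1 - t) / 2 + t * (1 + x i) / 2 else (1 - t) / 2 + t * (1 - x i) / 2)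
    (fun i b => (val b / t - x i) / n)
    (fun i => by simp; ring)
    (fun i => by simp [val]; field_simp; ring)).2.2
  have hs : ∀ σ : Fin n → Bool, (∑ i, val (σ i) / t) / n - μ = ∑ i, (val (σ i) / t - x i) / n := by
    intro σ
    simp only [μ]
    rw [← sub_div, ← Finset.sum_sub_distrib, Finset.sum_div]
  simp only [hs, prob]
  rw [key]
  have hi : ∀ i, ((if (true : Bool) then (1 - t) / 2 + t * (1 + x i) / 2 else (1 - t) / 2 + t * (1 - x i) / 2) * ((val true / t - x i) / n) ^ 2 + (if (false : Bool) then (1 - t) / 2 + t * (1 + x i) / 2 else (1 - t) / 2 + t * (1 - x i) / 2) * ((val false / t - x i) / n) ^ 2)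
      = (1 - t ^ 2 * x i ^ 2) / ((n : ℝ) ^ 2 * t ^ 2) := by
    intro i
    simp [val]
    field_simp
    ring
  rw [Finset.sum_congr rfl fun i _ => hi i, ← Finset.sum_div, Finset.sum_sub_distrib,
    ← Finset.mul_sum]
  simp
end

section
/- Fix ε > 0, write u = e^{ε/2} and s = (u+1)/(u-1). For x̃ ∈ [-1,1] let f be the PM output density for input x̃. Then ∫_ℝ x' f(x') dx' = x̃; i.e., the Piecewise Mechanism is an unbiased estimator of its input. -/
open MeasureTheory

/-- The PM mechanism is unbiased: the expectation `∫ x' f(x') dx'` of the PM output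
for input `x̃ ∈ [-1,1]` equals `x̃`. -/
theorem stmt_7 (ε : ℝ) (hε : 0 < ε) (xt : ℝ) (hxt : xt ∈ Set.Icc (-1 : ℝ) 1) :
    let u : ℝ := Real.exp (ε / 2)
    let s : ℝ := (u + 1) / (u - 1)
    let lb : ℝ := (u * xt - 1) / (u - 1)
    let rb : ℝ := (u * xt + 1) / (u - 1)
    let f : ℝ → ℝ := fun x' =>
      if lb ≤ x' ∧ x' ≤ rb then u * (u - 1) / (2 * (u + 1))
      else if -s ≤ x' ∧ x' ≤ s then (u - 1) / (2 * (u + u ^ 2)) else 0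
    (∫ x' : ℝ, x' * f x') = xt := by
  intro u s lb rb f
  have hu : 1 < u := Real.one_lt_exp_iff.mpr (by linarith)
  have hu1 : 0 < u - 1 := by linarith
  obtain ⟨h1, h2⟩ := hxt
  have hrs : rb ≤ s := div_le_div_of_nonneg_right (by nlinarith) hu1.le
  have hls : -s ≤ lb := by
    have : -s = (-(u + 1)) / (u - 1) := by simp only [s]; ring
    rw [this]
    exact div_le_div_of_nonneg_right (by nlinarith) hu1.le
  have hlr : lb ≤ rb := div_le_div_of_nonneg_right (by linarith) hu1.le
  have hss : -s ≤ s := by linarith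
  obtain ⟨p, hp⟩ : ∃ p, p = u * (u - 1) / (2 * (u + 1)) := ⟨_, rfl⟩
  obtain ⟨q, hq⟩ : ∃ q, q = (u - 1) / (2 * (u + u ^ 2)) := ⟨_, rfl⟩
  have hf : (fun x' : ℝ => x' * f x') = fun x' =>
      (Set.Icc lb rb).indicator (fun x => (p - q) * x) x' +
      (Set.Icc (-s) s).indicator (fun x => q * x) x' := by
    funext x
    simp only [f, ← hp, ← hq, Set.indicator_apply, Set.mem_Icc]
    by_cases ha : lb ≤ x ∧ x ≤ rb
    · have hb : -s ≤ x ∧ x ≤ s := ⟨hls.trans ha.1, ha.2.trans hrs⟩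
      rw [if_pos ha, if_pos ha, if_pos hb]; ring
    · rw [if_neg ha, if_neg ha]
      split_ifs <;> ring
  have key : ∀ a b c : ℝ, a ≤ b →
      Integrable ((Set.Icc a b).indicator (fun x => c * x)) ∧
      ∫ x, (Set.Icc a b).indicator (fun x => c * x) x = c * ((b ^ 2 - a ^ 2) / 2) := by
    intro a b c hab
    constructor
    · rw [integrable_indicator_iff measurableSet_Icc]
      exact (by fun_prop : Continuous fun x : ℝ => c * x).continuousOn.integrableOn_Icc
    · rw [integral_indicator measurableSet_Icc, integral_Icc_eq_integral_Ioc,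
        ← intervalIntegral.integral_of_le hab, intervalIntegral.integral_const_mul, integral_id]
  rw [hf, integral_add (key _ _ _ hlr).1 (key _ _ _ hss).1, (key _ _ _ hlr).2, (key _ _ _ hss).2,
    hp, hq]
  have e1 : u - 1 ≠ 0 := hu1.ne'
  have e2 : u ≠ 0 := by linarith
  have e3 : u + 1 ≠ 0 := by linarith
  have e4 : u + u ^ 2 = u * (u + 1) := by ring
  rw [e4]
  simp only [lb, rb]
  clear_value u
  field_simp
  ring
end

section
/- Fix ε > 0, write u = e^{ε/2} and s = (u+1)/(u-1). For x̃ ∈ [-1,1] let f be the PM output density for input x̃. Then ∫_ℝ (x' - x̃)² f(x') dx' = x̃²/(u-1) + (u+3)/(3(u-1)²); i.e., a single PM report of x̃ has variance x̃²/(e^{ε/2}-1) + (e^{ε/2}+3)/(3(e^{ε/2}-1)²). -/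
open MeasureTheory

lemma aux_int (a b t c : ℝ) (h : a ≤ b) :
    Integrable ((Set.Icc a b).indicator (fun x : ℝ => c * (x - t) ^ 2)) ∧
    ∫ x, (Set.Icc a b).indicator (fun x : ℝ => c * (x - t) ^ 2) x
      = c * (((b - t) ^ 3 - (a - t) ^ 3) / 3) := by
  constructor
  · rw [integrable_indicator_iff measurableSet_Icc]
    exact (by fun_prop : Continuous fun x : ℝ => c * (x - t) ^ 2).continuousOn.integrableOn_Icc
  · rw [integral_indicator measurableSet_Icc, integral_Icc_eq_integral_Ioc,
      ← intervalIntegral.integral_of_le h, intervalIntegral.integral_const_mul,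
      intervalIntegral.integral_comp_sub_right (fun x => x ^ 2), integral_pow]
    norm_num

/-- Variance of a single PM report of `x̃ ∈ [-1,1]`:
`∫ (x' - x̃)² f(x') dx' = x̃²/(u-1) + (u+3)/(3(u-1)²)` with `u = e^{ε/2}`. -/
theorem stmt_8 (ε : ℝ) (hε : 0 < ε) (xt : ℝ) (hxt : xt ∈ Set.Icc (-1 : ℝ) 1) :
    let u : ℝ := Real.exp (ε / 2)
    let s : ℝ := (u + 1) / (u - 1)
    let lb : ℝ := (u * xt - 1) / (u - 1)
    let rb : ℝ := (u * xt + 1) / (u - 1)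
    let f : ℝ → ℝ := fun x' =>
      if lb ≤ x' ∧ x' ≤ rb then u * (u - 1) / (2 * (u + 1))
      else if -s ≤ x' ∧ x' ≤ s then (u - 1) / (2 * (u + u ^ 2)) else 0
    (∫ x' : ℝ, (x' - xt) ^ 2 * f x') = xt ^ 2 / (u - 1) + (u + 3) / (3 * (u - 1) ^ 2) := by
  intro u s lb rb f
  obtain ⟨h1, h2⟩ := hxt
  have hu : 1 < u := Real.one_lt_exp_iff.mpr (by linarith)
  have hd : 0 < u - 1 := by linarith
  have hlr : lb ≤ rb := by
    apply div_le_div_of_nonneg_right _ hd.le; linarith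
  have hs : 0 < s := div_pos (by linarith) hd
  have hl : -s ≤ lb := by
    simp only [s, lb, ← neg_div]
    apply div_le_div_of_nonneg_right _ hd.le; nlinarith
  have hr : rb ≤ s := by
    apply div_le_div_of_nonneg_right _ hd.le; nlinarith
  obtain ⟨i1, e1⟩ := aux_int lb rb xt
    (u * (u - 1) / (2 * (u + 1)) - (u - 1) / (2 * (u + u ^ 2))) hlr
  obtain ⟨i2, e2⟩ := aux_int (-s) s xt ((u - 1) / (2 * (u + u ^ 2))) (by linarith)
  have key : (fun x' : ℝ => (x' - xt) ^ 2 * f x') = fun x' =>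
      (Set.Icc lb rb).indicator (fun x : ℝ =>
        (u * (u - 1) / (2 * (u + 1)) - (u - 1) / (2 * (u + u ^ 2))) * (x - xt) ^ 2) x' +
      (Set.Icc (-s) s).indicator (fun x : ℝ => ((u - 1) / (2 * (u + u ^ 2))) * (x - xt) ^ 2) x' := by
    funext x
    simp only [f, Set.indicator_apply, Set.mem_Icc]
    by_cases a : lb ≤ x ∧ x ≤ rb
    · have b : -s ≤ x ∧ x ≤ s := ⟨hl.trans a.1, a.2.trans hr⟩
      rw [if_pos a, if_pos a, if_pos b]; ring
    · rw [if_neg a, if_neg a]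
      split_ifs <;> ring
  rw [key, integral_add i1 i2, e1, e2]
  clear_value u
  simp only [s, lb, rb]
  have n1 : u - 1 ≠ 0 := hd.ne'
  have n2 : u + 1 ≠ 0 := by positivity
  have n3 : u ≠ 0 := by positivity
  have n4 : u + u ^ 2 = u * (u + 1) := by ring
  rw [n4]
  field_simp
  ring
end

section
/- Fix ε > 0 and write u = e^{ε/2}. Let x_1,…,x_n ∈ [-1,1] with mean μ = (1/n)Σ_{i=1}^n x_i, and let X'_1,…,X'_n be independent random variables where X'_i is distributed according to the PM output density for input x_i. Let μ̂_PM = (1/n)Σ_{i=1}^n X'_i. Then E[(μ̂_PM - μ)²] = (u+3)/(3n(u-1)²) + (Σ_{i=1}^n x_i²)/(n²(u-1)). -/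
open MeasureTheory Finset

lemma aux_int_s9 (g φ : ℝ → ℝ) (a b l r s : ℝ) (hlr : l ≤ r) (hs : -s ≤ s)
    (hg : ∀ y, g y = (Set.Icc l r).indicator (fun _ => a) y + (Set.Icc (-s) s).indicator (fun _ => b) y)
    (hφ : Continuous φ) :
    Integrable (fun y => g y * φ y) ∧
    ∫ y, g y * φ y = a * (∫ y in l..r, φ y) + b * (∫ y in (-s)..s, φ y) := by
  have e : (fun y => g y * φ y) = fun y => (Set.Icc l r).indicator (fun y => a * φ y) y
      + (Set.Icc (-s) s).indicator (fun y => b * φ y) y := by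
    funext y
    rw [hg, add_mul, Set.indicator_mul_left, Set.indicator_mul_left]
  have h1 : Integrable ((Set.Icc l r).indicator (fun y => a * φ y)) :=
    ((continuous_const.mul hφ).integrableOn_Icc).integrable_indicator measurableSet_Icc
  have h2 : Integrable ((Set.Icc (-s) s).indicator (fun y => b * φ y)) :=
    ((continuous_const.mul hφ).integrableOn_Icc).integrable_indicator measurableSet_Icc
  rw [e]
  refine ⟨h1.add h2, ?_⟩
  rw [integral_add h1 h2, integral_indicator measurableSet_Icc, integral_indicator measurableSet_Icc,
    intervalIntegral.integral_of_le hlr, intervalIntegral.integral_of_le hs,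
    integral_Icc_eq_integral_Ioc, integral_Icc_eq_integral_Ioc,
    integral_const_mul, integral_const_mul]

lemma aux_poly (l r x : ℝ) : (∫ y in l..r, (y - x)) = ((r - x)^2 - (l - x)^2) / 2 ∧
    (∫ y in l..r, (y - x)^2) = ((r - x)^3 - (l - x)^3) / 3 := by
  constructor
  · rw [intervalIntegral.integral_comp_sub_right (fun y => y)]
    simp
  · rw [intervalIntegral.integral_comp_sub_right (fun y => y ^ 2)]
    rw [integral_pow]; norm_num

lemma aux_prod {n : ℕ} (g : Fin n → ℝ → ℝ) (x v : Fin n → ℝ)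
    (i0 : ∀ i, Integrable (g i)) (i1 : ∀ i, Integrable (fun y => g i y * (y - x i)))
    (i2 : ∀ i, Integrable (fun y => g i y * (y - x i) ^ 2))
    (m0 : ∀ i, ∫ y, g i y = 1) (m1 : ∀ i, ∫ y, g i y * (y - x i) = 0)
    (m2 : ∀ i, ∫ y, g i y * (y - x i) ^ 2 = v i) :
    ∫ y : Fin n → ℝ, (∏ i, g i (y i)) * (∑ i, (y i - x i)) ^ 2 = ∑ i, v i := by
  classical
  let G : Fin n → Fin n → Fin n → ℝ → ℝ := fun i j k y =>
    g k y * ((if k = i then (y - x k) else 1) * (if k = j then (y - x k) else 1))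
  have hG : ∀ i j k, Integrable (G i j k) := by
    intro i j k
    simp only [G]
    by_cases h1 : k = i <;> by_cases h2 : k = j
    · simpa only [if_pos h1, if_pos h2, ← sq] using i2 k
    · simpa only [if_pos h1, if_neg h2, mul_one] using i1 k
    · simpa only [if_neg h1, if_pos h2, one_mul] using i1 k
    · simpa only [if_neg h1, if_neg h2, mul_one] using i0 k
  have e : (fun y : Fin n → ℝ => (∏ i, g i (y i)) * (∑ i, (y i - x i)) ^ 2)
      = fun y => ∑ i, ∑ j, ∏ k, G i j k (y k) := by
    funext y
    rw [sq, Finset.sum_mul_sum, Finset.mul_sum]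
    refine Finset.sum_congr rfl fun i _ => ?_
    rw [Finset.mul_sum]
    refine Finset.sum_congr rfl fun j _ => ?_
    simp only [G]
    rw [Finset.prod_mul_distrib, Finset.prod_mul_distrib, Finset.prod_ite_eq', Finset.prod_ite_eq']
    simp
  have hI : ∀ i j, Integrable (fun y : Fin n → ℝ => ∏ k, G i j k (y k)) := fun i j =>
    Integrable.fintype_prod (fun k => hG i j k)
  rw [e, integral_finsetSum _ (fun i _ => integrable_finsetSum _ (fun j _ => hI i j))]
  refine Finset.sum_congr rfl fun i _ => ?_
  rw [integral_finsetSum _ (fun j _ => hI i j), Finset.sum_eq_single i]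
  · rw [integral_fintype_prod_volume_eq_prod, Finset.prod_eq_single i]
    · simp only [G, if_true, ← sq]
      exact m2 i
    · intro k _ hk
      simp only [G, if_neg hk, mul_one]
      exact m0 k
    · simp
  · intro j _ hj
    rw [integral_fintype_prod_volume_eq_prod]
    apply Finset.prod_eq_zero (Finset.mem_univ i)
    simp only [G, if_true, if_neg hj.symm, mul_one]
    exact m1 i
  · simp

/-- PM part of Lemma 1 of the paper: for `n` independent PM reports `X'ᵢ` of values
`x₁,…,xₙ ∈ [-1,1]` and `μ̂ = (1/n) Σ X'ᵢ`, the mean squared error around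
`μ = (1/n) Σ xᵢ` equals `(u+3)/(3n(u-1)²) + (Σ xᵢ²)/(n²(u-1))` with `u = e^{ε/2}`.
The expectation is written as an integral against the product of the PM densities. -/
theorem stmt_9 (ε : ℝ) (hε : 0 < ε) (n : ℕ) (hn : 0 < n)
    (x : Fin n → ℝ) (hx : ∀ i, x i ∈ Set.Icc (-1 : ℝ) 1) :
    let u : ℝ := Real.exp (ε / 2)
    let s : ℝ := (u + 1) / (u - 1)
    let f : ℝ → ℝ → ℝ := fun xt x' =>
      if (u * xt - 1) / (u - 1) ≤ x' ∧ x' ≤ (u * xt + 1) / (u - 1) then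
        u * (u - 1) / (2 * (u + 1))
      else if -s ≤ x' ∧ x' ≤ s then (u - 1) / (2 * (u + u ^ 2)) else 0
    let μ : ℝ := (∑ i, x i) / n
    (∫ y : Fin n → ℝ, (∏ i, f (x i) (y i)) * ((∑ i, y i) / n - μ) ^ 2) =
      (u + 3) / (3 * n * (u - 1) ^ 2) + (∑ i, (x i) ^ 2) / ((n : ℝ) ^ 2 * (u - 1)) := by
  intro u s f μ
  have hu : 1 < u := Real.one_lt_exp_iff.mpr (by linarith)
  have hu1 : 0 < u - 1 := by linarith
  have hu0 : 0 < u := by linarith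
  have hne : u - 1 ≠ 0 := hu1.ne'
  have hs : 0 < s := div_pos (by linarith) hu1
  have hn' : (n : ℝ) ≠ 0 := by exact_mod_cast hn.ne'
  have hlr : ∀ i, (u * x i - 1) / (u - 1) ≤ (u * x i + 1) / (u - 1) := fun i => by
    gcongr; linarith
  have hg : ∀ i y, f (x i) y =
      (Set.Icc ((u * x i - 1) / (u - 1)) ((u * x i + 1) / (u - 1))).indicator
        (fun _ => (u - 1) ^ 2 / (2 * u)) y
      + (Set.Icc (-s) s).indicator (fun _ => (u - 1) / (2 * (u + u ^ 2))) y := by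
    intro i y
    obtain ⟨ha, hb⟩ := hx i
    have h1 : -s ≤ (u * x i - 1) / (u - 1) := by
      simp only [s]; rw [← neg_div]; gcongr; nlinarith
    have h2 : (u * x i + 1) / (u - 1) ≤ s := by
      simp only [s]; gcongr; nlinarith
    simp only [f, Set.indicator_apply, Set.mem_Icc]
    by_cases h : (u * x i - 1) / (u - 1) ≤ y ∧ y ≤ (u * x i + 1) / (u - 1)
    · rw [if_pos h, if_pos h, if_pos ⟨h1.trans h.1, h.2.trans h2⟩]
      field_simp
      ring
    · rw [if_neg h, if_neg h, zero_add]
  have key := fun i (φ : ℝ → ℝ) (hφ : Continuous φ) =>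
    aux_int_s9 (f (x i)) φ _ _ _ _ s (hlr i) (by linarith) (hg i) hφ
  have k0 := fun i => key i (fun _ => 1) continuous_const
  have k1 := fun i => key i (fun y => y - x i) (by fun_prop)
  have k2 := fun i => key i (fun y => (y - x i) ^ 2) (by fun_prop)
  simp only [mul_one] at k0
  have main := aux_prod (fun i => f (x i)) x
    (fun i => (u + 3) / (3 * (u - 1) ^ 2) + x i ^ 2 / (u - 1))
    (fun i => (k0 i).1) (fun i => (k1 i).1) (fun i => (k2 i).1)
    (fun i => by
      rw [(k0 i).2]
      simp only [intervalIntegral.integral_const, smul_eq_mul, s]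
      field_simp
      ring)
    (fun i => by
      rw [(k1 i).2, (aux_poly _ _ _).1, (aux_poly _ _ _).1]
      simp only [s]
      field_simp
      ring)
    (fun i => by
      rw [(k2 i).2, (aux_poly _ _ _).2, (aux_poly _ _ _).2]
      simp only [s]
      field_simp
      ring)
  have e : (fun y : Fin n → ℝ => (∏ i, f (x i) (y i)) * ((∑ i, y i) / n - μ) ^ 2)
      = fun y => ((∏ i, f (x i) (y i)) * (∑ i, (y i - x i)) ^ 2) * (1 / (n : ℝ) ^ 2) := by
    funext y
    simp only [μ, Finset.sum_sub_distrib]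
    field_simp
  rw [e, integral_mul_const, main, Finset.sum_add_distrib]
  simp only [Finset.sum_const, Finset.card_univ, Fintype.card_fin, nsmul_eq_mul, ← Finset.sum_div]
  field_simp
end

section
/- For ε > 0 let t(ε) = (e^ε - 1)/(e^ε + 1). Let n > 0 and m ≥ 0 be reals, and let S and P be any reals. Define Err(ε) = (2n - 2t(ε)²S)/((m+n)² t(ε)²) + S/(m+n)² + P. Then for all 0 < ε₁ < ε₂ one has Err(ε₂) < Err(ε₁); i.e., the attack error on the mean of the output poisoning attack against the SR mechanism is strictly decreasing in the privacy budget ε. -/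
/-- SR-mean part of Theorem 3 (security–privacy consistency of OPA): the OPA mean attack
error against the SR mechanism is strictly decreasing in the privacy budget `ε`. -/
theorem stmt_16 (n : ℝ) (hn : 0 < n) (m : ℝ) (hm : 0 ≤ m) (S P : ℝ) :
    let t : ℝ → ℝ := fun ε => (Real.exp ε - 1) / (Real.exp ε + 1)
    let Err : ℝ → ℝ := fun ε =>
      (2 * n - 2 * (t ε) ^ 2 * S) / ((m + n) ^ 2 * (t ε) ^ 2) + S / (m + n) ^ 2 + P
    ∀ ε₁ ε₂ : ℝ, 0 < ε₁ → ε₁ < ε₂ → Err ε₂ < Err ε₁ := by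
  intro t Err ε₁ ε₂ h1 h12
  have e1 : 1 < Real.exp ε₁ := Real.one_lt_exp_iff.mpr h1
  have e12 : Real.exp ε₁ < Real.exp ε₂ := Real.exp_lt_exp.mpr h12
  have ht1 : 0 < t ε₁ := div_pos (by linarith) (by linarith)
  have ht12 : t ε₁ < t ε₂ := by
    change (Real.exp ε₁ - 1) / (Real.exp ε₁ + 1) < (Real.exp ε₂ - 1) / (Real.exp ε₂ + 1)
    rw [div_lt_div_iff₀ (by linarith) (by linarith)]
    nlinarith
  have hmn : 0 < (m + n) ^ 2 := by positivity
  have key : ∀ a : ℝ, 0 < a → (2 * n - 2 * a ^ 2 * S) / ((m + n) ^ 2 * a ^ 2)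
      = 2 * n / ((m + n) ^ 2 * a ^ 2) - 2 * S / (m + n) ^ 2 := by
    intro a ha
    have h := hmn.ne'
    have hmn' : m + n ≠ 0 := by positivity
    field_simp
  change (2 * n - 2 * (t ε₂) ^ 2 * S) / ((m + n) ^ 2 * (t ε₂) ^ 2) + S / (m + n) ^ 2 + P
    < (2 * n - 2 * (t ε₁) ^ 2 * S) / ((m + n) ^ 2 * (t ε₁) ^ 2) + S / (m + n) ^ 2 + P
  rw [key _ ht1, key _ (ht1.trans ht12)]
  have hsq : (t ε₁) ^ 2 < (t ε₂) ^ 2 := pow_lt_pow_left₀ ht12 ht1.le two_ne_zero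
  have : 2 * n / ((m + n) ^ 2 * (t ε₂) ^ 2) < 2 * n / ((m + n) ^ 2 * (t ε₁) ^ 2) :=
    div_lt_div_of_pos_left (by positivity) (by positivity) (mul_lt_mul_of_pos_left hsq hmn)
  linarith
end

section
/- Let n > 0 and m ≥ 0 be reals, let S ≥ 0 and P be reals, and for ε > 0 define Err(ε) = 2n(e^{ε/2}+3)/(3(m+n)²(e^{ε/2}-1)²) + (1+e^{ε/2})S/((m+n)²(e^{ε/2}-1)) + P. Then for all 0 < ε₁ < ε₂ one has Err(ε₂) < Err(ε₁); i.e., the attack error on the mean of the output poisoning attack against the PM mechanism is strictly decreasing in the privacy budget ε. -/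
/-- PM-mean part of Theorem 3 (security–privacy consistency of OPA): the OPA mean attack
error against the PM mechanism is strictly decreasing in the privacy budget `ε`. -/
theorem stmt_17 (n : ℝ) (hn : 0 < n) (m : ℝ) (hm : 0 ≤ m) (S : ℝ) (hS : 0 ≤ S) (P : ℝ) :
    let Err : ℝ → ℝ := fun ε =>
      2 * n * (Real.exp (ε / 2) + 3) / (3 * (m + n) ^ 2 * (Real.exp (ε / 2) - 1) ^ 2) +
        (1 + Real.exp (ε / 2)) * S / ((m + n) ^ 2 * (Real.exp (ε / 2) - 1)) + P
    ∀ ε₁ ε₂ : ℝ, 0 < ε₁ → ε₁ < ε₂ → Err ε₂ < Err ε₁ := by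
  intro Err ε₁ ε₂ h1 h12
  have hD : 0 < (m + n) ^ 2 := by positivity
  have key : ∀ ε : ℝ, 0 < ε → Err ε =
      2 * n / (3 * (m + n) ^ 2) * ((Real.exp (ε / 2) - 1)⁻¹ + 4 * (Real.exp (ε / 2) - 1)⁻¹ ^ 2) +
        S / (m + n) ^ 2 * (1 + 2 * (Real.exp (ε / 2) - 1)⁻¹) + P := by
    intro ε hε
    have hu : 0 < Real.exp (ε / 2) - 1 := by
      have := Real.one_lt_exp_iff.mpr (half_pos hε)
      linarith
    have hmn : m + n ≠ 0 := by positivity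
    simp only [Err]
    generalize hx : Real.exp (ε / 2) - 1 = u at *
    have hy : Real.exp (ε / 2) = u + 1 := by linarith
    rw [hy]
    have hu' := hu.ne'
    field_simp
    ring
  rw [key ε₁ h1, key ε₂ (h1.trans h12)]
  have hu : 0 < Real.exp (ε₁ / 2) - 1 := by
    have := Real.one_lt_exp_iff.mpr (half_pos h1)
    linarith
  have huv : Real.exp (ε₁ / 2) - 1 < Real.exp (ε₂ / 2) - 1 := by
    have := Real.exp_lt_exp.mpr (show ε₁ / 2 < ε₂ / 2 by linarith)
    linarith
  have hv := hu.trans huv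
  have hq := inv_pos.mpr hv
  have hpq := (inv_lt_inv₀ hv hu).mpr huv
  generalize (Real.exp (ε₁ / 2) - 1)⁻¹ = p at *
  generalize (Real.exp (ε₂ / 2) - 1)⁻¹ = q at *
  have hA : 0 < 2 * n / (3 * (m + n) ^ 2) := by positivity
  have hB : 0 ≤ S / (m + n) ^ 2 := by positivity
  have e1 : q + 4 * q ^ 2 < p + 4 * p ^ 2 := by nlinarith
  have e2 := mul_lt_mul_of_pos_left e1 hA
  have e3 := mul_le_mul_of_nonneg_left (show 1 + 2 * q ≤ 1 + 2 * p by linarith) hB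
  linarith
end
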